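/- Assume there are constants 0 < a ≤ b such that a ≤ p(Y|θ) ≤ b for all (Y,θ). Then there exists a constant C > 0 depending only on a and b such that for every M ≥ 1, | E[log p̂_M(Y)] − E[log p(Y)] + (1/(2M))·E[ Var[p(Y|θ̃)|Y] / p(Y)² ] | ≤ C/M², where Y has density p(Y), θ̃ and θ̃_1,…,θ̃_M are i.i.d. with density π independent of Y, p̂_M(Y) = (1/M) Σ_{m=1}^M p(Y|θ̃_m), and Var[p(Y|θ̃)|Y] is the conditional variance of p(Y|θ̃) given Y. Consequently the inner-averaging bias of the DLMC estimator satisfies |I − E[I_dl]| ≤ C_{dl,4}/M + C/M² with C_{dl,4} = (1/2)·E[ Var[p(Y|θ̃)|Y] / p(Y)² ] (the bias estimate of Proposition 1). -/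

import Mathlib

open MeasureTheory

/-- The evidence `p(Y) = ∫ p(Y|θ) π(θ) dθ`. -/
noncomputable def evidence {d q : ℕ} (π : (Fin d → ℝ) → ℝ)
    (p : (Fin q → ℝ) → (Fin d → ℝ) → ℝ) (Y : Fin q → ℝ) : ℝ :=
  ∫ θ, p Y θ * π θ

/-- The expected information gain `I = E[log (p(Y|θ)/p(Y))]` with `(θ, Y)` distributed with
joint density `p(Y|θ) π(θ)`. -/
noncomputable def infoGain {d q : ℕ} (π : (Fin d → ℝ) → ℝ)
    (p : (Fin q → ℝ) → (Fin d → ℝ) → ℝ) : ℝ :=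
  ∫ z : (Fin d → ℝ) × (Fin q → ℝ), Real.log (p z.2 z.1 / evidence π p z.2)
    ∂(volume.withDensity fun z => ENNReal.ofReal (p z.2 z.1 * π z.1))

/-- The joint law of all samples used by the DLMC estimator: the `N` outer pairs
`(θ_n, Y_n)` are i.i.d. with joint density `p(Y|θ)π(θ)` and the `N·M` inner samples
`θ̃_{n,m}` are i.i.d. with density `π`, all independent. -/
noncomputable def dlmcLaw {d q : ℕ} (π : (Fin d → ℝ) → ℝ)
    (p : (Fin q → ℝ) → (Fin d → ℝ) → ℝ) (N M : ℕ) :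
    Measure ((Fin N → (Fin d → ℝ) × (Fin q → ℝ)) × (Fin N → Fin M → (Fin d → ℝ))) :=
  volume.withDensity fun ω => ENNReal.ofReal
    ((∏ n, p (ω.1 n).2 (ω.1 n).1 * π (ω.1 n).1) * ∏ n, ∏ m, π (ω.2 n m))

/-- The double-loop Monte Carlo estimator
`I_dl = (1/N) ∑ₙ log (p(Yₙ|θₙ) / ((1/M) ∑ₘ p(Yₙ|θ̃ₙₘ)))`. -/
noncomputable def Idl {d q : ℕ} (p : (Fin q → ℝ) → (Fin d → ℝ) → ℝ) (N M : ℕ)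
    (ω : (Fin N → (Fin d → ℝ) × (Fin q → ℝ)) × (Fin N → Fin M → (Fin d → ℝ))) : ℝ :=
  (N : ℝ)⁻¹ * ∑ n, Real.log
    (p (ω.1 n).2 (ω.1 n).1 / ((M : ℝ)⁻¹ * ∑ m, p (ω.1 n).2 (ω.2 n m)))

/-- `E[log p̂_M(Y)]`, where `Y` has density `p(Y)` and the `θ̃_m`, `m = 1,…,M`, are
i.i.d. with density `π`, independent of `Y`, and `p̂_M(Y) = (1/M) ∑ₘ p(Y|θ̃ₘ)`. -/
noncomputable def ElogPhat {d q : ℕ} (π : (Fin d → ℝ) → ℝ)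
    (p : (Fin q → ℝ) → (Fin d → ℝ) → ℝ) (M : ℕ) : ℝ :=
  ∫ w : (Fin q → ℝ) × (Fin M → (Fin d → ℝ)),
      Real.log ((M : ℝ)⁻¹ * ∑ m, p w.1 (w.2 m))
    ∂(volume.withDensity fun w => ENNReal.ofReal (evidence π p w.1 * ∏ m, π (w.2 m)))

/-- `E[log p(Y)]` where `Y` has density `p(Y)`. -/
noncomputable def ElogEvidence {d q : ℕ} (π : (Fin d → ℝ) → ℝ)
    (p : (Fin q → ℝ) → (Fin d → ℝ) → ℝ) : ℝ :=
  ∫ Y : Fin q → ℝ, Real.log (evidence π p Y)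
    ∂(volume.withDensity fun Y => ENNReal.ofReal (evidence π p Y))

/-- The conditional variance `Var[p(Y|θ̃) | Y]` of the likelihood over `θ̃ ~ π`. -/
noncomputable def condVarLik {d q : ℕ} (π : (Fin d → ℝ) → ℝ)
    (p : (Fin q → ℝ) → (Fin d → ℝ) → ℝ) (Y : Fin q → ℝ) : ℝ :=
  ∫ θ, (p Y θ - evidence π p Y) ^ 2 * π θ

open ProbabilityTheory

/-- Third-order Taylor estimate for the logarithm, with a fourth-order remainder. -/
lemma abs_log_one_add_sub_taylor_le {r t : ℝ} (hr : 0 < r) (hr1 : r ≤ 1) (ht : r ≤ 1 + t) :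
    |Real.log (1 + t) - (t - t ^ 2 / 2 + t ^ 3 / 3)| ≤ r⁻¹ * t ^ 4 := by
  have hpos : ∀ x ∈ Set.uIcc 0 t, r ≤ 1 + x := by
    intro x hx
    rcases Set.mem_uIcc.1 hx with h | h <;> linarith [h.1, h.2]
  have key := Convex.norm_image_sub_le_of_norm_hasDerivWithin_le (𝕜 := ℝ)
    (f := fun x => Real.log (1 + x) - (x - x ^ 2 / 2 + x ^ 3 / 3))
    (f' := fun x => -x ^ 3 / (1 + x)) (s := Set.uIcc 0 t) (C := r⁻¹ * |t| ^ 3)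
    (x := 0) (y := t) ?_ ?_ (convex_uIcc 0 t) Set.left_mem_uIcc Set.right_mem_uIcc
  · simp only [Real.norm_eq_abs, add_zero, Real.log_one, sub_zero] at key
    norm_num at key
    calc _ ≤ _ := key
      _ = r⁻¹ * |t| ^ 4 := by ring
      _ = r⁻¹ * t ^ 4 := by rw [Even.pow_abs ⟨2, rfl⟩]
  · intro x hx
    have hx0 : 1 + x ≠ 0 := (hr.trans_le (hpos x hx)).ne'
    have h1 : HasDerivAt (fun x : ℝ => 1 + x) 1 x := by
      simpa using (hasDerivAt_id x).const_add 1
    have h2 := (h1.log hx0).sub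
      (((hasDerivAt_id x).sub (((hasDerivAt_id x).pow 2).div_const 2)).add
        (((hasDerivAt_id x).pow 3).div_const 3))
    refine HasDerivAt.hasDerivWithinAt (h2.congr_deriv ?_)
    simp only [id]
    field_simp
    ring
  · intro x hx
    have h1 := hpos x hx
    have h2 : |x| ≤ |t| := by
      rcases Set.mem_uIcc.1 hx with h | h
      · exact abs_le_abs_of_nonneg h.1 h.2
      · exact abs_le_abs_of_nonpos h.2 h.1
    rw [Real.norm_eq_abs, abs_div, abs_neg, abs_pow, abs_of_pos (hr.trans_le h1),
      div_eq_inv_mul]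
    gcongr

/-- The first four moments of a sum of independent, centred, bounded random variables. -/
lemma ProbabilityTheory.iIndepFun.moments_sum_of_bounded {Ω ι : Type*}
    {mΩ : MeasurableSpace Ω} {P : Measure Ω} [IsProbabilityMeasure P] {X : ι → Ω → ℝ}
    (hX : iIndepFun X P) (hm : ∀ i, Measurable (X i))
    {B v k : ℝ} (hb : ∀ i, ∀ᵐ ω ∂P, |X i ω| ≤ B) (h1 : ∀ i, ∫ ω, X i ω ∂P = 0)
    (h2 : ∀ i, ∫ ω, X i ω ^ 2 ∂P = v) (h3 : ∀ i, ∫ ω, X i ω ^ 3 ∂P = k) (s : Finset ι) :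
    ∫ ω, (∑ i ∈ s, X i ω) ∂P = 0 ∧ ∫ ω, (∑ i ∈ s, X i ω) ^ 2 ∂P = s.card * v ∧
    ∫ ω, (∑ i ∈ s, X i ω) ^ 3 ∂P = s.card * k ∧
    ∫ ω, (∑ i ∈ s, X i ω) ^ 4 ∂P ≤ 3 * (s.card : ℝ) ^ 2 * B ^ 4 := by
  classical
  induction s using Finset.induction_on with
  | empty => simp
  | insert i s hi ih =>
    obtain ⟨e1, e2, e3, e4⟩ := ih
    set S : Ω → ℝ := fun ω => ∑ j ∈ s, X j ω with hS
    have hSm : Measurable S := Finset.measurable_sum _ fun j _ => hm j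
    have hind : IndepFun S (X i) P := by
      have := hX.indepFun_finsetSum_of_notMem hm hi
      convert this using 1
      ext ω
      simp [hS]
    have hSb : ∀ᵐ ω ∂P, |S ω| ≤ ∑ j ∈ s, B := by
      have := (Finset.eventually_all s (l := ae P) (p := fun j ω => |X j ω| ≤ B)).2 fun j _ => hb j
      filter_upwards [this] with ω hω
      exact (Finset.abs_sum_le_sum_abs _ _).trans (Finset.sum_le_sum hω)
    have hint : ∀ m n : ℕ, Integrable (fun ω => S ω ^ m * X i ω ^ n) P := by
      intro m n
      refine Integrable.of_bound ((hSm.pow_const m).mul ((hm i).pow_const n)).aestronglyMeasurable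
        ((∑ j ∈ s, B) ^ m * B ^ n) ?_
      filter_upwards [hSb, hb i] with ω h h'
      rw [Real.norm_eq_abs, abs_mul, abs_pow, abs_pow]
      have := (abs_nonneg _).trans h
      gcongr
    have hmul : ∀ m n : ℕ, ∫ ω, S ω ^ m * X i ω ^ n ∂P =
        (∫ ω, S ω ^ m ∂P) * ∫ ω, X i ω ^ n ∂P := by
      intro m n
      have h := hind.comp (measurable_id.pow_const m) (measurable_id.pow_const n)
      exact h.integral_fun_mul_eq_mul_integral
        (hSm.pow_const m).aestronglyMeasurable ((hm i).pow_const n).aestronglyMeasurable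
    have hbin : ∀ n : ℕ, ∫ ω, (X i ω + S ω) ^ n ∂P = ∑ j ∈ Finset.range (n + 1),
        (∫ ω, S ω ^ j ∂P) * (∫ ω, X i ω ^ (n - j) ∂P) * (n.choose j : ℝ) := by
      intro n
      simp_rw [add_comm (X i _), add_pow]
      rw [integral_finsetSum _ fun j _ => (hint _ _).mul_const _]
      simp_rw [integral_mul_const, hmul]
    have hv : v ≤ B ^ 2 := by
      rw [← h2 i]
      have : ∫ ω, X i ω ^ 2 ∂P ≤ ∫ ω, B ^ 2 ∂P := by
        refine integral_mono_ae (by simpa using hint 0 2) (integrable_const _) ?_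
        filter_upwards [hb i] with ω h
        exact sq_le_sq.2 (h.trans (le_abs_self _))
      simpa using this
    have hv0 : 0 ≤ v := by
      rw [← h2 i]; exact integral_nonneg fun ω => sq_nonneg _
    have h4 : ∫ ω, X i ω ^ 4 ∂P ≤ B ^ 4 := by
      have : ∫ ω, X i ω ^ 4 ∂P ≤ ∫ ω, B ^ 4 ∂P := by
        refine integral_mono_ae (by simpa using hint 0 4) (integrable_const _) ?_
        filter_upwards [hb i] with ω h
        calc X i ω ^ 4 = |X i ω| ^ 4 := by rw [Even.pow_abs ⟨2, rfl⟩]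
          _ ≤ B ^ 4 := by gcongr
      simpa using this
    simp only [Finset.sum_insert hi, Finset.card_insert_of_notMem hi]
    push_cast
    change ∫ ω, S ω ∂P = 0 at e1
    change ∫ ω, S ω ^ 2 ∂P = s.card * v at e2
    change ∫ ω, S ω ^ 3 ∂P = s.card * k at e3
    change ∫ ω, S ω ^ 4 ∂P ≤ 3 * (s.card : ℝ) ^ 2 * B ^ 4 at e4
    have i1 : Integrable (X i) P := by simpa using hint 0 1
    have i2 : Integrable S P := by simpa using hint 1 0
    refine ⟨?_, ?_, ?_, ?_⟩
    · change ∫ ω, (X i ω + S ω) ∂P = 0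
      rw [integral_add i1 i2, h1, e1, add_zero]
    · change ∫ ω, (X i ω + S ω) ^ 2 ∂P = _
      rw [hbin]
      simp [Finset.sum_range_succ, h1, h2, e1, e2]
      ring
    · change ∫ ω, (X i ω + S ω) ^ 3 ∂P = _
      rw [hbin]
      simp [Finset.sum_range_succ, h1, h2, h3, e1, e2, e3]
      ring
    · change ∫ ω, (X i ω + S ω) ^ 4 ∂P ≤ _
      rw [hbin]
      simp only [Finset.sum_range_succ, Finset.sum_range_zero, pow_one, pow_zero, h1, h2, e1, e2,
        integral_const, probReal_univ, smul_eq_mul, mul_one, one_mul, mul_zero, zero_mul,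
        Nat.sub_self, Nat.sub_zero, Nat.reduceSub, Nat.choose, Nat.reduceAdd, Nat.cast_ofNat,
        Nat.cast_one, add_zero, zero_add]
      have hvv : v * v ≤ B ^ 2 * B ^ 2 := mul_le_mul hv hv hv0 (sq_nonneg B)
      have : (s.card : ℝ) * (v * v) ≤ s.card * (B ^ 2 * B ^ 2) := by gcongr
      have hB4 : 0 ≤ B ^ 4 := by positivity
      nlinarith

lemma inv_mul_sum_mem_Icc {M : ℕ} (hM : 1 ≤ M) {a b : ℝ} {x : Fin M → ℝ}
    (hx : ∀ m, a ≤ x m ∧ x m ≤ b) : a ≤ (M : ℝ)⁻¹ * ∑ m, x m ∧ (M : ℝ)⁻¹ * ∑ m, x m ≤ b := by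
  have hM0 : (0 : ℝ) < M := by exact_mod_cast hM
  have h1 : ∑ _m : Fin M, a ≤ ∑ m, x m := Finset.sum_le_sum fun m _ => (hx m).1
  have h2 : ∑ m, x m ≤ ∑ _m : Fin M, b := Finset.sum_le_sum fun m _ => (hx m).2
  simp only [Finset.sum_const, Finset.card_univ, Fintype.card_fin, nsmul_eq_mul] at h1 h2
  rw [le_inv_mul_iff₀ hM0, inv_mul_le_iff₀ hM0]
  exact ⟨h1, h2⟩

lemma integrable_log_of_ae_mem_Icc {α : Type*} [MeasurableSpace α] {μ : Measure α}
    [IsFiniteMeasure μ] {f : α → ℝ} (hf : Measurable f) {a b : ℝ} (ha : 0 < a)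
    (h : ∀ᵐ x ∂μ, a ≤ f x ∧ f x ≤ b) : Integrable (fun x => Real.log (f x)) μ := by
  refine Integrable.of_bound (Real.measurable_log.comp hf).aestronglyMeasurable
    (max |Real.log a| |Real.log b|) ?_
  filter_upwards [h] with x hx
  exact abs_le_max_abs_abs (Real.log_le_log ha hx.1) (Real.log_le_log (ha.trans_le hx.1) hx.2)

/-- Second-order expansion of the expected logarithm of an empirical mean of `M` independent
copies of a random variable with values in `[a, b]`. -/
lemma abs_integral_log_mean_sub_le {α : Type*} [MeasurableSpace α] {μ : Measure α}
    [IsProbabilityMeasure μ] {f : α → ℝ} (hf : Measurable f) {a b : ℝ} (ha : 0 < a)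
    (hfab : ∀ᵐ x ∂μ, a ≤ f x ∧ f x ≤ b) {M : ℕ} (hM : 1 ≤ M) :
    |∫ w, Real.log ((M : ℝ)⁻¹ * ∑ m, f (w m)) ∂(Measure.pi fun _ : Fin M => μ)
        - Real.log (∫ x, f x ∂μ)
        + (1 / (2 * (M : ℝ))) * ((∫ x, (f x - ∫ y, f y ∂μ) ^ 2 ∂μ) / (∫ x, f x ∂μ) ^ 2)|
      ≤ (b ^ 3 / a ^ 3 + 3 * (b / a) * (b ^ 4 / a ^ 4)) / (M : ℝ) ^ 2 := by
  have hM0 : (0 : ℝ) < M := by exact_mod_cast hM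
  have hfi : Integrable f μ := by
    refine Integrable.of_bound hf.aestronglyMeasurable b ?_
    filter_upwards [hfab] with x hx
    rw [Real.norm_eq_abs, abs_of_pos (ha.trans_le hx.1)]
    exact hx.2
  set c := ∫ x, f x ∂μ with hc
  have hca : a ≤ c := by
    have : ∫ _, a ∂μ ≤ c := integral_mono_ae (integrable_const _) hfi (hfab.mono fun x h => h.1)
    simpa using this
  have hcb : c ≤ b := by
    have : c ≤ ∫ _, b ∂μ := integral_mono_ae hfi (integrable_const _) (hfab.mono fun x h => h.2)
    simpa using this
  have hc0 : 0 < c := ha.trans_le hca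
  have hb0 : 0 < b := hc0.trans_le hcb
  set g : α → ℝ := fun x => f x - c with hg
  have hgm : Measurable g := hf.sub_const c
  have hgb : ∀ᵐ x ∂μ, |g x| ≤ b := by
    filter_upwards [hfab] with x hx
    rw [abs_le]
    constructor <;> simp only [hg] <;> linarith [hx.1, hx.2]
  set P := Measure.pi fun _ : Fin M => μ with hP
  have hev : ∀ m : Fin M, MeasurePreserving (fun w : Fin M → α => w m) P μ :=
    fun m => measurePreserving_eval _ m
  have hind : iIndepFun (fun (m : Fin M) (w : Fin M → α) => g (w m)) P :=
    iIndepFun_pi fun _ => hgm.aemeasurable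
  have hcomp : ∀ (n : ℕ) (m : Fin M), ∫ w, g (w m) ^ n ∂P = ∫ x, g x ^ n ∂μ :=
    fun n m => integral_comp_eval (μ := fun _ : Fin M => μ) (i := m) (f := fun x => g x ^ n)
      (hgm.pow_const n).aestronglyMeasurable
  have hg0 : ∫ x, g x ∂μ = 0 := by
    simp only [hg]
    rw [integral_sub hfi (integrable_const _)]
    simp [hc]
  have hXm : ∀ m : Fin M, Measurable fun w : Fin M → α => g (w m) :=
    fun m => hgm.comp (measurable_pi_apply m)
  obtain ⟨e1, e2, e3, e4⟩ := hind.moments_sum_of_bounded hXm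
    (fun m => (hev m).quasiMeasurePreserving.ae hgb)
    (fun m => by simpa [hg0] using hcomp 1 m) (hcomp 2) (hcomp 3) Finset.univ
  simp only [Finset.card_univ, Fintype.card_fin] at e2 e3 e4
  set S : (Fin M → α) → ℝ := fun w => ∑ m, g (w m) with hS
  have hSm : Measurable S := Finset.measurable_sum _ fun m _ => hXm m
  have hall : ∀ᵐ w ∂P, ∀ m, a ≤ f (w m) ∧ f (w m) ≤ b :=
    ae_all_iff.2 fun m => (hev m).quasiMeasurePreserving.ae hfab
  have hmean : ∀ w : Fin M → α, (M : ℝ)⁻¹ * ∑ m, f (w m) = c * (1 + S w / (M * c)) := by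
    intro w
    simp only [hS, hg, Finset.sum_sub_distrib, Finset.sum_const, Finset.card_univ,
      Fintype.card_fin, nsmul_eq_mul]
    field_simp
    ring
  have hlow : ∀ᵐ w ∂P, a ≤ (M : ℝ)⁻¹ * ∑ m, f (w m) ∧ (M : ℝ)⁻¹ * ∑ m, f (w m) ≤ b := by
    filter_upwards [hall] with w hw using inv_mul_sum_mem_Icc hM hw
  have hSb : ∀ᵐ w ∂P, |S w| ≤ M * b := by
    filter_upwards [ae_all_iff.2 fun m => (hev m).quasiMeasurePreserving.ae hgb] with w hw
    refine (Finset.abs_sum_le_sum_abs _ _).trans ((Finset.sum_le_sum fun m _ => hw m).trans ?_)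
    simp
  have hSi : ∀ n : ℕ, Integrable (fun w => S w ^ n) P := by
    intro n
    refine Integrable.of_bound (hSm.pow_const n).aestronglyMeasurable ((M * b) ^ n) ?_
    filter_upwards [hSb] with w hw
    rw [Real.norm_eq_abs, abs_pow]
    gcongr
  have hS1 : Integrable S P := by simpa using hSi 1
  set L : (Fin M → α) → ℝ := fun w => Real.log ((M : ℝ)⁻¹ * ∑ m, f (w m)) with hL
  have hLm : Measurable fun w : Fin M → α => (M : ℝ)⁻¹ * ∑ m, f (w m) :=
    (Finset.measurable_sum _ fun m _ => hf.comp (measurable_pi_apply m)).const_mul _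
  have hpt : ∀ᵐ w ∂P, |L w - Real.log c - (S w * (M * c)⁻¹ - S w ^ 2 * (2 * (M * c) ^ 2)⁻¹
      + S w ^ 3 * (3 * (M * c) ^ 3)⁻¹)| ≤ S w ^ 4 * ((b / a) * ((M * c) ^ 4)⁻¹) := by
    filter_upwards [hlow] with w hw
    have hr : a / b ≤ 1 + S w / (M * c) := by
      have h := hw.1
      rw [hmean] at h
      have h' : a / c ≤ 1 + S w / (M * c) := by rw [div_le_iff₀ hc0]; linarith
      exact (by gcongr : a / b ≤ a / c).trans h'
    have hab : 0 < a / b := by positivity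
    have := abs_log_one_add_sub_taylor_le hab ((div_le_one hb0).2 (hca.trans hcb)) hr
    simp only [hL]
    rw [hmean, Real.log_mul hc0.ne' (hab.trans_le hr).ne']
    convert this using 1
    · congr 1
      field_simp
      ring
    · field_simp
  have hLi : Integrable L P := integrable_log_of_ae_mem_Icc hLm ha hlow
  have hI := norm_integral_le_of_norm_le (f := fun w => L w - Real.log c
    - (S w * (M * c)⁻¹ - S w ^ 2 * (2 * (M * c) ^ 2)⁻¹ + S w ^ 3 * (3 * (M * c) ^ 3)⁻¹))
    ((hSi 4).mul_const _) hpt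
  have i1 := hS1.mul_const ((M * c)⁻¹)
  have i2 := (hSi 2).mul_const ((2 * (M * c) ^ 2)⁻¹)
  have i3 := (hSi 3).mul_const ((3 * (M * c) ^ 3)⁻¹)
  have i12 : Integrable (fun w => S w * (M * c)⁻¹ - S w ^ 2 * (2 * (M * c) ^ 2)⁻¹) P := i1.sub i2
  have i123 : Integrable (fun w => S w * (M * c)⁻¹ - S w ^ 2 * (2 * (M * c) ^ 2)⁻¹
      + S w ^ 3 * (3 * (M * c) ^ 3)⁻¹) P := i12.add i3
  have i0 : Integrable (fun w => L w - Real.log c) P := hLi.sub (integrable_const _)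
  rw [integral_sub i0 i123, integral_sub hLi (integrable_const _), integral_add i12 i3,
    integral_sub i1 i2,
    integral_mul_const, integral_mul_const, integral_mul_const, integral_mul_const] at hI
  change ∫ w, S w ∂P = 0 at e1
  change ∫ w, S w ^ 2 ∂P = _ at e2
  change ∫ w, S w ^ 3 ∂P = _ at e3
  change ∫ w, S w ^ 4 ∂P ≤ _ at e4
  rw [e1, e2, e3, Real.norm_eq_abs] at hI
  simp only [integral_const, probReal_univ, smul_eq_mul, one_mul, zero_mul, zero_sub] at hI
  change |∫ w, L w ∂P - Real.log c + (1 / (2 * (M : ℝ))) * ((∫ x, g x ^ 2 ∂μ) / c ^ 2)| ≤ _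
  have hk : |∫ x, g x ^ 3 ∂μ| ≤ b ^ 3 := by
    have : ∀ᵐ x ∂μ, ‖g x ^ 3‖ ≤ b ^ 3 := by
      filter_upwards [hgb] with x hx
      rw [Real.norm_eq_abs, abs_pow]
      gcongr
    simpa using norm_integral_le_of_norm_le_const this
  set v := ∫ x, g x ^ 2 ∂μ
  set k := ∫ x, g x ^ 3 ∂μ
  have hq : (∫ w, S w ^ 4 ∂P) * (b / a * ((M * c) ^ 4)⁻¹)
      ≤ 3 * (b / a) * (b ^ 4 / a ^ 4) / (M : ℝ) ^ 2 := by
    calc _ ≤ (3 * (M : ℝ) ^ 2 * b ^ 4) * (b / a * ((M * a) ^ 4)⁻¹) := by gcongr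
      _ = _ := by field_simp
  have hk' : |M * k * (3 * (M * c) ^ 3)⁻¹| ≤ b ^ 3 / a ^ 3 / (M : ℝ) ^ 2 := by
    rw [abs_mul, abs_mul, abs_of_pos hM0, abs_of_pos (by positivity : 0 < (3 * (M * c) ^ 3)⁻¹)]
    calc _ ≤ M * b ^ 3 * (1 * (M * a) ^ 3)⁻¹ := by gcongr; norm_num
      _ = _ := by field_simp
  have : ∫ w, L w ∂P - Real.log c + (1 / (2 * (M : ℝ))) * (v / c ^ 2)
      = (∫ w, L w ∂P - Real.log c - (-(M * v * (2 * (M * c) ^ 2)⁻¹) + M * k * (3 * (M * c) ^ 3)⁻¹))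
        + M * k * (3 * (M * c) ^ 3)⁻¹ := by
    field_simp
    ring
  rw [this, add_div]
  refine (abs_add_le _ _).trans ?_
  rw [add_comm]
  exact add_le_add hk' (hI.trans hq)

/-- A finite power of a measure with an integrable density is the measure with the product
density. -/
lemma pi_withDensity_ofReal {ι E : Type*} [Fintype ι] [MeasurableSpace E] {μ : Measure E}
    [SigmaFinite μ] {f : E → ℝ} (hf : Integrable f μ) (hf0 : ∀ x, 0 ≤ f x) :
    Measure.pi (fun _ : ι => μ.withDensity fun x => ENNReal.ofReal (f x))
      = (Measure.pi fun _ : ι => μ).withDensity fun x => ENNReal.ofReal (∏ i, f (x i)) := by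
  refine Measure.pi_eq fun s hs => ?_
  rw [withDensity_apply _ (MeasurableSet.univ_pi hs), Measure.restrict_pi_pi,
    ← ofReal_integral_eq_lintegral_ofReal
      (Integrable.fintype_prod_dep fun i => hf.restrict (s := s i))
      (ae_of_all _ fun x => Finset.prod_nonneg fun i _ => hf0 _),
    integral_fintype_prod_eq_prod,
    ENNReal.ofReal_prod_of_nonneg fun i _ => integral_nonneg fun x => hf0 x]
  refine Finset.prod_congr rfl fun i _ => ?_
  rw [withDensity_apply _ (hs i),
    ofReal_integral_eq_lintegral_ofReal hf.restrict (ae_of_all _ hf0)]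

lemma integral_withDensity_ofReal_eq {α : Type*} [MeasurableSpace α] {μ : Measure α} {f : α → ℝ}
    (hf : Measurable f) (hf0 : ∀ x, 0 ≤ f x) (g : α → ℝ) :
    ∫ x, g x ∂(μ.withDensity fun x => ENNReal.ofReal (f x)) = ∫ x, g x * f x ∂μ := by
  rw [integral_withDensity_eq_integral_toReal_smul hf.ennreal_ofReal
    (ae_of_all _ fun _ => ENNReal.ofReal_lt_top)]
  simp [ENNReal.toReal_ofReal (hf0 _), mul_comm]

lemma ae_withDensity_ofReal_of_eq_zero {α : Type*} [MeasurableSpace α] {μ : Measure α}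
    {f : α → ℝ} (hf : Measurable f) {s : α → Prop} (h : ∀ x, ¬ s x → f x = 0) :
    ∀ᵐ x ∂(μ.withDensity fun x => ENNReal.ofReal (f x)), s x := by
  rw [ae_withDensity_iff hf.ennreal_ofReal]
  refine ae_of_all _ fun x hx => ?_
  by_contra hs
  exact hx (by simp [h x hs])

lemma isProbabilityMeasure_withDensity_ofReal {α : Type*} [MeasurableSpace α] {μ : Measure α}
    {f : α → ℝ} (hf0 : ∀ x, 0 ≤ f x) (h1 : ∫ x, f x ∂μ = 1) :
    IsProbabilityMeasure (μ.withDensity fun x => ENNReal.ofReal (f x)) := by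
  refine ⟨?_⟩
  rw [withDensity_apply _ MeasurableSet.univ, Measure.restrict_univ,
    ← ofReal_integral_eq_lintegral_ofReal (.of_integral_ne_zero (by simp [h1])) (ae_of_all _ hf0),
    h1, ENNReal.ofReal_one]

lemma integral_comp_eq_of_measurePreserving {α β : Type*} [MeasurableSpace α]
    [MeasurableSpace β] {μ : Measure α} {ν : Measure β} {f : α → β} (hf : MeasurePreserving f μ ν)
    {g : β → ℝ} (hg : AEStronglyMeasurable g ν) : ∫ x, g (f x) ∂μ = ∫ y, g y ∂ν := by
  have h := integral_map hf.measurable.aemeasurable (hf.map_eq.symm ▸ hg)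
  rw [hf.map_eq] at h
  exact h.symm

set_option maxHeartbeats 2000000 in
/-- Second-order expansion of the inner-averaging bias of the DLMC estimator: there is a
constant `C > 0` depending only on `a` and `b` such that for every `M ≥ 1`,
`|E[log p̂_M(Y)] − E[log p(Y)] + (1/(2M)) E[Var[p(Y|θ̃)|Y]/p(Y)²]| ≤ C/M²`; consequently
`|I − E[I_dl]| ≤ C_{dl,4}/M + C/M²` with `C_{dl,4} = (1/2) E[Var[p(Y|θ̃)|Y]/p(Y)²]`. -/
theorem dlmc_bias_estimate (a b : ℝ) (ha : 0 < a) (hab : a ≤ b) :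
    ∃ C : ℝ, 0 < C ∧
      ∀ (d q : ℕ) (Θ : Set (Fin d → ℝ)) (𝓨 : Set (Fin q → ℝ)),
        MeasurableSet Θ → MeasurableSet 𝓨 →
      ∀ (π : (Fin d → ℝ) → ℝ) (p : (Fin q → ℝ) → (Fin d → ℝ) → ℝ),
        Measurable π → (∀ θ, 0 ≤ π θ) → (∀ θ ∉ Θ, π θ = 0) → (∫ θ, π θ = 1) →
        Measurable (Function.uncurry p) → (∀ Y θ, 0 ≤ p Y θ) →
        (∀ θ, ∀ Y ∉ 𝓨, p Y θ = 0) → (∀ θ ∈ Θ, ∫ Y, p Y θ = 1) →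
        (∀ θ ∈ Θ, ∀ Y ∈ 𝓨, a ≤ p Y θ ∧ p Y θ ≤ b) →
      ∀ M : ℕ, 1 ≤ M →
        |ElogPhat π p M - ElogEvidence π p
            + (1 / (2 * (M : ℝ))) * ∫ Y : Fin q → ℝ, condVarLik π p Y / (evidence π p Y) ^ 2
                ∂(volume.withDensity fun Y => ENNReal.ofReal (evidence π p Y))|
          ≤ C / (M : ℝ) ^ 2
        ∧ ∀ N : ℕ, 1 ≤ N →
            |infoGain π p - ∫ ω, Idl p N M ω ∂(dlmcLaw π p N M)|
              ≤ ((1 / 2) * ∫ Y : Fin q → ℝ, condVarLik π p Y / (evidence π p Y) ^ 2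
                    ∂(volume.withDensity fun Y => ENNReal.ofReal (evidence π p Y))) / (M : ℝ)
                + C / (M : ℝ) ^ 2 := by
  have hb0 : 0 < b := ha.trans_le hab
  refine ⟨b ^ 3 / a ^ 3 + 3 * (b / a) * (b ^ 4 / a ^ 4), by positivity, ?_⟩
  intro d q Θ 𝓨 _ _ π p hπm hπ0 hπΘ hπ1 hpm hp0 hp𝓨 hp1 hpab M hM
  have hM0 : (0 : ℝ) < M := by exact_mod_cast hM
  have hπi : Integrable π := .of_integral_ne_zero (by simp [hπ1])
  have hpY : ∀ Y, Measurable (p Y) := fun Y => hpm.comp measurable_prodMk_left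
  have hpθ : ∀ θ, Measurable fun Y => p Y θ := fun θ => hpm.comp measurable_prodMk_right
  -- the prior
  set μ : Measure (Fin d → ℝ) := volume.withDensity fun θ => ENNReal.ofReal (π θ) with hμ
  have : IsProbabilityMeasure μ := isProbabilityMeasure_withDensity_ofReal hπ0 hπ1
  have hμΘ : ∀ᵐ θ ∂μ, θ ∈ Θ := ae_withDensity_ofReal_of_eq_zero hπm hπΘ
  have hev : ∀ Y, evidence π p Y = ∫ θ, p Y θ ∂μ := fun Y =>
    (integral_withDensity_ofReal_eq hπm hπ0 _).symm
  have hcv : ∀ Y, condVarLik π p Y = ∫ θ, (p Y θ - ∫ θ', p Y θ' ∂μ) ^ 2 ∂μ := fun Y => by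
    rw [← hev Y]
    exact (integral_withDensity_ofReal_eq hπm hπ0 _).symm
  have hpΘ : ∀ Y ∈ 𝓨, ∀ᵐ θ ∂μ, a ≤ p Y θ ∧ p Y θ ≤ b := fun Y hY => by
    filter_upwards [hμΘ] with θ hθ using hpab θ hθ Y hY
  have hpi : ∀ Y, Integrable (p Y) μ := fun Y => by
    by_cases hY : Y ∈ 𝓨
    · refine Integrable.of_bound (hpY Y).aestronglyMeasurable b ?_
      filter_upwards [hpΘ Y hY] with θ h
      rw [Real.norm_eq_abs, abs_of_nonneg (hp0 _ _)]
      exact h.2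
    · have : p Y = fun _ => 0 := funext fun θ => hp𝓨 θ Y hY
      rw [this]
      exact integrable_zero _ _ _
  have hevm : Measurable (evidence π p) := by
    have : StronglyMeasurable fun Y => ∫ θ, p Y θ * π θ :=
      (hpm.mul (hπm.comp measurable_snd)).stronglyMeasurable.integral_prod_right
    exact this.measurable
  have hev0 : ∀ Y, 0 ≤ evidence π p Y := fun Y =>
    integral_nonneg fun θ => mul_nonneg (hp0 _ _) (hπ0 _)
  have hev𝓨 : ∀ Y ∈ 𝓨, a ≤ evidence π p Y ∧ evidence π p Y ≤ b := fun Y hY => by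
    rw [hev]
    constructor
    · simpa using integral_mono_ae (integrable_const a) (hpi Y) ((hpΘ Y hY).mono fun θ h => h.1)
    · simpa using integral_mono_ae (hpi Y) (integrable_const b) ((hpΘ Y hY).mono fun θ h => h.2)
  -- the joint law of parameter and data
  have hpsw : Measurable fun z : (Fin d → ℝ) × (Fin q → ℝ) => p z.2 z.1 := hpm.comp measurable_swap
  have hJm : Measurable fun z : (Fin d → ℝ) × (Fin q → ℝ) => p z.2 z.1 * π z.1 :=
    hpsw.mul (hπm.comp measurable_fst)
  have hJ0 : ∀ z : (Fin d → ℝ) × (Fin q → ℝ), 0 ≤ p z.2 z.1 * π z.1 :=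
    fun z => mul_nonneg (hp0 _ _) (hπ0 _)
  have hJ1 : ∫⁻ z : (Fin d → ℝ) × (Fin q → ℝ), ENNReal.ofReal (p z.2 z.1 * π z.1) = 1 := by
    rw [Measure.volume_eq_prod, lintegral_prod _ hJm.ennreal_ofReal.aemeasurable]
    have : ∀ θ, ∫⁻ Y, ENNReal.ofReal (p Y θ * π θ) = ENNReal.ofReal (π θ) := fun θ => by
      by_cases hθ : θ ∈ Θ
      · simp_rw [ENNReal.ofReal_mul (hp0 _ _)]
        rw [lintegral_mul_const _ (hpθ θ).ennreal_ofReal, ← ofReal_integral_eq_lintegral_ofReal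
          (.of_integral_ne_zero (by simp [hp1 θ hθ])) (ae_of_all _ fun Y => hp0 Y θ), hp1 θ hθ]
        simp
      · simp [hπΘ θ hθ]
    simp_rw [this]
    rw [← ofReal_integral_eq_lintegral_ofReal hπi (ae_of_all _ hπ0), hπ1, ENNReal.ofReal_one]
  have hJi : Integrable fun z : (Fin d → ℝ) × (Fin q → ℝ) => p z.2 z.1 * π z.1 := by
    refine ⟨hJm.aestronglyMeasurable, ?_⟩
    rw [hasFiniteIntegral_iff_ofReal (ae_of_all _ hJ0), hJ1]
    exact ENNReal.one_lt_top
  set J : Measure ((Fin d → ℝ) × (Fin q → ℝ)) :=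
    volume.withDensity fun z => ENNReal.ofReal (p z.2 z.1 * π z.1) with hJ
  have : IsProbabilityMeasure J := ⟨by
    rw [hJ, withDensity_apply _ MeasurableSet.univ, Measure.restrict_univ, hJ1]⟩
  have hJae : ∀ᵐ z ∂J, z.1 ∈ Θ ∧ z.2 ∈ 𝓨 := by
    refine ae_withDensity_ofReal_of_eq_zero hJm fun z hz => ?_
    by_cases h : z.1 ∈ Θ
    · simp [hp𝓨 z.1 z.2 fun h' => hz ⟨h, h'⟩]
    · simp [hπΘ z.1 h]
  -- the marginal law of the data
  set ν : Measure (Fin q → ℝ) := volume.withDensity fun Y => ENNReal.ofReal (evidence π p Y) with hν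
  have hsnd : MeasurePreserving Prod.snd J ν := by
    refine ⟨measurable_snd, Measure.ext fun s hs => ?_⟩
    rw [Measure.map_apply measurable_snd hs, hJ, hν, withDensity_apply _ (measurable_snd hs),
      withDensity_apply _ hs, ← Set.univ_prod, Measure.volume_eq_prod, ← Measure.prod_restrict,
      Measure.restrict_univ, lintegral_prod_symm _ hJm.ennreal_ofReal.aemeasurable]
    refine lintegral_congr fun Y => ?_
    have h1 : Integrable fun θ => p Y θ * π θ := by
      have := hpi Y
      rw [hμ, integrable_withDensity_iff hπm.ennreal_ofReal
        (ae_of_all _ fun _ => ENNReal.ofReal_lt_top)] at this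
      simpa [ENNReal.toReal_ofReal (hπ0 _)] using this
    exact (ofReal_integral_eq_lintegral_ofReal h1
      (ae_of_all _ fun θ => mul_nonneg (hp0 _ _) (hπ0 _))).symm
  have : IsProbabilityMeasure ν :=
    hsnd.map_eq ▸ Measure.isProbabilityMeasure_map measurable_snd.aemeasurable
  have hν𝓨 : ∀ᵐ Y ∂ν, Y ∈ 𝓨 := by
    refine ae_withDensity_ofReal_of_eq_zero hevm fun Y hY => ?_
    simp [evidence, hp𝓨 _ Y hY]
  -- the inner samples
  set P : Measure (Fin M → Fin d → ℝ) := Measure.pi fun _ => μ with hP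
  have hPΘ : ∀ᵐ w ∂P, ∀ m, w m ∈ Θ := ae_all_iff.2 fun m =>
    (measurePreserving_eval (fun _ : Fin M => μ) m).quasiMeasurePreserving.ae hμΘ
  have hPd : P = volume.withDensity fun w => ENNReal.ofReal (∏ m, π (w m)) :=
    pi_withDensity_ofReal hπi hπ0
  have hprod : Measurable fun w : Fin M → Fin d → ℝ => ∏ m, π (w m) :=
    Finset.measurable_prod _ fun m _ => hπm.comp (measurable_pi_apply m)
  have hFm : Measurable fun w : (Fin q → ℝ) × (Fin M → Fin d → ℝ) =>
      (M : ℝ)⁻¹ * ∑ m, p w.1 (w.2 m) :=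
    (Finset.measurable_sum _ fun m _ => hpm.comp (measurable_fst.prodMk
      ((measurable_pi_apply m).comp measurable_snd))).const_mul _
  have hFb : ∀ᵐ w ∂(ν.prod P),
      a ≤ (M : ℝ)⁻¹ * ∑ m, p w.1 (w.2 m) ∧ (M : ℝ)⁻¹ * ∑ m, p w.1 (w.2 m) ≤ b := by
    filter_upwards [Measure.quasiMeasurePreserving_fst.ae hν𝓨,
      Measure.quasiMeasurePreserving_snd.ae hPΘ] with w h1 h2
    exact inv_mul_sum_mem_Icc hM fun m => hpab _ (h2 m) _ h1
  have hFi := integrable_log_of_ae_mem_Icc hFm ha hFb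
  have hPhat : ElogPhat π p M = ∫ w, Real.log ((M : ℝ)⁻¹ * ∑ m, p w.1 (w.2 m)) ∂(ν.prod P) := by
    rw [ElogPhat, hν, hPd, prod_withDensity hevm.ennreal_ofReal hprod.ennreal_ofReal,
      ← Measure.volume_eq_prod]
    simp_rw [ENNReal.ofReal_mul (hev0 _)]
  have hEi : Integrable (fun Y => Real.log (evidence π p Y)) ν :=
    integrable_log_of_ae_mem_Icc hevm ha (hν𝓨.mono hev𝓨)
  have hVm : Measurable (condVarLik π p) := by
    have : StronglyMeasurable fun Y => ∫ θ, (p Y θ - evidence π p Y) ^ 2 * π θ :=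
      (((hpm.sub (hevm.comp measurable_fst)).pow_const 2).mul
        (hπm.comp measurable_snd)).stronglyMeasurable.integral_prod_right
    exact this.measurable
  have hV0 : ∀ Y, 0 ≤ condVarLik π p Y := fun Y =>
    integral_nonneg fun θ => mul_nonneg (sq_nonneg _) (hπ0 _)
  have hVi : Integrable (fun Y => condVarLik π p Y / evidence π p Y ^ 2) ν := by
    refine Integrable.of_bound (hVm.div (hevm.pow_const 2)).aestronglyMeasurable (b ^ 2 / a ^ 2) ?_
    filter_upwards [hν𝓨] with Y hY
    have he := hev𝓨 Y hY
    rw [Real.norm_eq_abs, abs_of_nonneg (div_nonneg (hV0 Y) (sq_nonneg _))]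
    have : condVarLik π p Y ≤ b ^ 2 := by
      have h : ∀ᵐ θ ∂μ, ‖(p Y θ - ∫ θ', p Y θ' ∂μ) ^ 2‖ ≤ b ^ 2 := by
        filter_upwards [hpΘ Y hY] with θ h
        rw [← hev, Real.norm_eq_abs, abs_pow]
        have : |p Y θ - evidence π p Y| ≤ b := abs_le.2 ⟨by linarith, by linarith⟩
        gcongr
      rw [hcv]
      have := norm_integral_le_of_norm_le_const h
      rw [probReal_univ, mul_one] at this
      exact (le_abs_self _).trans this
    have := he.1
    gcongr
  have main : |ElogPhat π p M - ElogEvidence π p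
      + (1 / (2 * (M : ℝ))) * ∫ Y, condVarLik π p Y / (evidence π p Y) ^ 2 ∂ν|
        ≤ (b ^ 3 / a ^ 3 + 3 * (b / a) * (b ^ 4 / a ^ 4)) / (M : ℝ) ^ 2 := by
    have h1 : Integrable (fun Y => ∫ w, Real.log ((M : ℝ)⁻¹ * ∑ m, p Y (w m)) ∂P) ν :=
      hFi.integral_prod_left
    have h2 : Integrable (fun Y => ∫ w, Real.log ((M : ℝ)⁻¹ * ∑ m, p Y (w m)) ∂P
        - Real.log (evidence π p Y)) ν := h1.sub hEi
    have h3 : ElogPhat π p M = ∫ Y, ∫ w, Real.log ((M : ℝ)⁻¹ * ∑ m, p Y (w m)) ∂P ∂ν :=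
      hPhat.trans (integral_prod _ hFi)
    rw [h3, ElogEvidence, ← integral_const_mul, ← integral_sub h1 hEi,
      ← integral_add h2 (hVi.const_mul _)]
    have key : ∀ᵐ Y ∂ν, ‖∫ w, Real.log ((M : ℝ)⁻¹ * ∑ m, p Y (w m)) ∂P
        - Real.log (evidence π p Y)
        + (1 / (2 * (M : ℝ))) * (condVarLik π p Y / (evidence π p Y) ^ 2)‖
        ≤ (b ^ 3 / a ^ 3 + 3 * (b / a) * (b ^ 4 / a ^ 4)) / (M : ℝ) ^ 2 := by
      filter_upwards [hν𝓨] with Y hY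
      rw [hcv, hev, Real.norm_eq_abs]
      exact abs_integral_log_mean_sub_le (hpY Y) ha (hpΘ Y hY) hM
    simpa using norm_integral_le_of_norm_le_const key
  refine ⟨main, fun N hN => ?_⟩
  have hN0 : (0 : ℝ) < N := by exact_mod_cast hN
  have hlp : Integrable (fun z : (Fin d → ℝ) × (Fin q → ℝ) => Real.log (p z.2 z.1)) J :=
    integrable_log_of_ae_mem_Icc hpsw ha (hJae.mono fun z hz => hpab _ hz.1 _ hz.2)
  have hinfo : infoGain π p = ∫ z, Real.log (p z.2 z.1) ∂J - ElogEvidence π p := by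
    have h1 : infoGain π p = ∫ z, (Real.log (p z.2 z.1) - Real.log (evidence π p z.2)) ∂J := by
      refine integral_congr_ae ?_
      filter_upwards [hJae] with z hz
      exact Real.log_div (ha.trans_le (hpab _ hz.1 _ hz.2).1).ne' (ha.trans_le (hev𝓨 _ hz.2).1).ne'
    have h2 : Integrable (fun z : (Fin d → ℝ) × (Fin q → ℝ) => Real.log (evidence π p z.2)) J :=
      hsnd.integrable_comp_of_integrable hEi
    rw [h1, integral_sub hlp h2]
    congr 1
    exact integral_comp_eq_of_measurePreserving hsnd hEi.aestronglyMeasurable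
  have hlaw : dlmcLaw π p N M
      = (Measure.pi fun _ : Fin N => J).prod (Measure.pi fun _ : Fin N => P) := by
    have h1 : Integrable (fun w : Fin M → Fin d → ℝ => ∏ m, π (w m)) :=
      Integrable.fintype_prod fun _ => hπi
    have h2 : ∀ w : Fin M → Fin d → ℝ, 0 ≤ ∏ m, π (w m) :=
      fun w => Finset.prod_nonneg fun m _ => hπ0 _
    have h3 : Measurable fun x : Fin N → (Fin d → ℝ) × (Fin q → ℝ) =>
        ∏ n, p (x n).2 (x n).1 * π (x n).1 :=
      Finset.measurable_prod _ fun n _ => hJm.comp (measurable_pi_apply n)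
    have h4 : Measurable fun x : Fin N → Fin M → Fin d → ℝ => ∏ n, ∏ m, π (x n m) :=
      Finset.measurable_prod _ fun n _ => hprod.comp (measurable_pi_apply n)
    rw [hPd, hJ, pi_withDensity_ofReal hJi hJ0, pi_withDensity_ofReal h1 h2,
      prod_withDensity h3.ennreal_ofReal h4.ennreal_ofReal, dlmcLaw]
    simp_rw [ENNReal.ofReal_mul (Finset.prod_nonneg fun n _ => hJ0 _)]
    rfl
  set G : ((Fin d → ℝ) × (Fin q → ℝ)) × (Fin M → Fin d → ℝ) → ℝ :=
    fun u => Real.log (p u.1.2 u.1.1 / ((M : ℝ)⁻¹ * ∑ m, p u.1.2 (u.2 m))) with hG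
  have hpres : MeasurePreserving (Prod.map Prod.snd id) (J.prod P) (ν.prod P) :=
    hsnd.prod (MeasurePreserving.id P)
  have hGae : (fun u => Real.log (p u.1.2 u.1.1)
      - Real.log ((M : ℝ)⁻¹ * ∑ m, p u.1.2 (u.2 m))) =ᵐ[J.prod P] G := by
    filter_upwards [Measure.quasiMeasurePreserving_fst.ae hJae,
      hpres.quasiMeasurePreserving.ae hFb] with u h1 h2
    exact (Real.log_div (ha.trans_le (hpab _ h1.1 _ h1.2).1).ne' (ha.trans_le h2.1).ne').symm
  have hi1 : Integrable (fun u : ((Fin d → ℝ) × (Fin q → ℝ)) × (Fin M → Fin d → ℝ) =>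
      Real.log (p u.1.2 u.1.1)) (J.prod P) := hlp.comp_fst P
  have hi2 : Integrable (fun u : ((Fin d → ℝ) × (Fin q → ℝ)) × (Fin M → Fin d → ℝ) =>
      Real.log ((M : ℝ)⁻¹ * ∑ m, p u.1.2 (u.2 m))) (J.prod P) :=
    hpres.integrable_comp_of_integrable hFi
  have hGi : Integrable G (J.prod P) := (hi1.sub hi2).congr hGae
  have hGint : ∫ u, G u ∂(J.prod P) = ∫ z, Real.log (p z.2 z.1) ∂J - ElogPhat π p M := by
    rw [← integral_congr_ae hGae, integral_sub hi1 hi2, hPhat]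
    congr 1
    · simpa using integral_fun_fst (μ := J) (ν := P) fun z => Real.log (p z.2 z.1)
    · exact integral_comp_eq_of_measurePreserving hpres hFi.aestronglyMeasurable
  have hIdl : ∫ ω, Idl p N M ω ∂(dlmcLaw π p N M) = ∫ u, G u ∂(J.prod P) := by
    have hT : ∀ n : Fin N, MeasurePreserving (Prod.map (fun x => x n) fun x => x n)
        ((Measure.pi fun _ : Fin N => J).prod (Measure.pi fun _ : Fin N => P)) (J.prod P) :=
      fun n => (measurePreserving_eval (fun _ : Fin N => J) n).prod
        (measurePreserving_eval (fun _ : Fin N => P) n)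
    have hTG : ∀ n : Fin N, ∫ ω, G (ω.1 n, ω.2 n)
        ∂((Measure.pi fun _ : Fin N => J).prod (Measure.pi fun _ : Fin N => P))
          = ∫ u, G u ∂(J.prod P) :=
      fun n => integral_comp_eq_of_measurePreserving (hT n) hGi.aestronglyMeasurable
    have hTi : ∀ n : Fin N, Integrable (fun ω => G (ω.1 n, ω.2 n))
        ((Measure.pi fun _ : Fin N => J).prod (Measure.pi fun _ : Fin N => P)) :=
      fun n => (hT n).integrable_comp_of_integrable hGi
    have hI : ∀ ω, Idl p N M ω = (N : ℝ)⁻¹ * ∑ n, G (ω.1 n, ω.2 n) := fun _ => rfl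
    rw [hlaw]
    simp_rw [hI]
    rw [integral_const_mul, integral_finsetSum _ fun n _ => hTi n]
    simp_rw [hTG]
    simp only [Finset.sum_const, Finset.card_univ, Fintype.card_fin, nsmul_eq_mul]
    field_simp
  rw [hIdl, hGint, hinfo]
  set V := ∫ Y, condVarLik π p Y / (evidence π p Y) ^ 2 ∂ν with hV
  have hVnn : 0 ≤ V := integral_nonneg fun Y => div_nonneg (hV0 Y) (sq_nonneg _)
  have hVM : 0 ≤ 1 / 2 * V / (M : ℝ) := by positivity
  have heq : 1 / (2 * (M : ℝ)) * V = 1 / 2 * V / (M : ℝ) := by field_simp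
  rw [heq] at main
  have := abs_le.1 main
  rw [abs_le]
  constructor <;> linarith [this.1, this.2]
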